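/- Let I be the fat points ideal of a rank-3 arrangement of n lines in P^2_K as above. Then for all r ≥ 1, I^(2r) ⊆ M^r·I^r, where M = ⟨x,y,z⟩. In particular the Harbourne–Huneke conjecture I^(2r) ⊆ M^r I^r holds for this class of ideals. -/

import Mathlib

open scoped Classical

/-- The homogeneous ideal of a point of `ℙ²` with homogeneous coordinate vector `p`:
the ideal generated by all linear forms vanishing at `p`. -/
noncomputable def pointIdeal {K : Type*} [Field K] (p : Fin 3 → K) :
    Ideal (MvPolynomial (Fin 3) K) :=
  Ideal.span {f | f.IsHomogeneous 1 ∧ MvPolynomial.eval p f = 0}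

namespace FatPoints

open MvPolynomial

attribute [local instance] MvPolynomial.gradedAlgebra

section Homogeneous

variable {K σ τ : Type*} [Field K]

theorem eq_sum_of_isHomogeneous_one [Fintype σ] {f : MvPolynomial σ K} (hf : f.IsHomogeneous 1) :
    f = ∑ i, C (coeff (Finsupp.single i 1) f) * X i := by
  have h : f ∈ Submodule.span K (Set.range (X : σ → MvPolynomial σ K)) := by
    rw [← homogeneousSubmodule_one_eq_span_X]; exact hf
  obtain ⟨c, rfl⟩ := (Submodule.mem_span_range_iff_exists_fun K).1 h
  refine Finset.sum_congr rfl fun i _ => ?_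
  rw [coeff_sum, Finset.sum_eq_single i]
  · simp [smul_eq_C_mul]
  · intro j _ hj
    rw [coeff_smul, coeff_X, if_neg (by simpa [Finsupp.single_left_inj] using hj), smul_zero]
  · simp

theorem eval_smul_of_isHomogeneous_one [Fintype σ] {f : MvPolynomial σ K}
    (hf : f.IsHomogeneous 1) (c : K) (q : σ → K) : eval (c • q) f = c * eval q f := by
  rw [eq_sum_of_isHomogeneous_one hf]
  simp only [map_sum, map_mul, eval_C, eval_X, Pi.smul_apply, smul_eq_mul, Finset.mul_sum]
  exact Finset.sum_congr rfl fun i _ => by ring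

theorem homogeneousComponent_mul_of_isHomogeneous {a : ℕ} {x : MvPolynomial σ K}
    (hx : x.IsHomogeneous a) (d : ℕ) (g : MvPolynomial σ K) :
    homogeneousComponent (a + d) (x * g) = x * homogeneousComponent d g := by
  conv_lhs => rw [← sum_homogeneousComponent g, Finset.mul_sum, map_sum]
  conv_rhs => rw [← sum_homogeneousComponent g, map_sum, Finset.mul_sum]
  refine Finset.sum_congr rfl fun i _ => ?_
  rw [homogeneousComponent_of_mem (hx.mul (homogeneousComponent_isHomogeneous i g)),
    homogeneousComponent_of_mem (homogeneousComponent_isHomogeneous i g)]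
  by_cases h : d = i
  · simp [h]
  · simp [h]

theorem isHomogeneous_of_mul {a d : ℕ} {x g : MvPolynomial σ K} (hx : x.IsHomogeneous a)
    (hx0 : x ≠ 0) (h : (x * g).IsHomogeneous (a + d)) : g.IsHomogeneous d := by
  have h1 := homogeneousComponent_mul_of_isHomogeneous hx d g
  rw [homogeneousComponent_eq_self h] at h1
  rw [mul_left_cancel₀ hx0 h1]
  exact homogeneousComponent_isHomogeneous d g

theorem isHomogeneous_map {ρ : MvPolynomial σ K →ₐ[K] MvPolynomial τ K}
    (hρ : ∀ i, (ρ (X i)).IsHomogeneous 1) {d : ℕ} {f : MvPolynomial σ K}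
    (hf : f.IsHomogeneous d) : (ρ f).IsHomogeneous d := by
  have h := hf.aeval (fun i => ρ (X i)) hρ
  rw [one_mul] at h
  rw [aeval_unique ρ]
  exact h

theorem homogeneousComponent_map {ρ : MvPolynomial σ K →ₐ[K] MvPolynomial τ K}
    (hρ : ∀ i, (ρ (X i)).IsHomogeneous 1) (d : ℕ) (f : MvPolynomial σ K) :
    homogeneousComponent d (ρ f) = ρ (homogeneousComponent d f) := by
  conv_lhs => rw [← sum_homogeneousComponent f, map_sum, map_sum]
  conv_rhs => rw [← sum_homogeneousComponent f, map_sum, map_sum]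
  refine Finset.sum_congr rfl fun i _ => ?_
  rw [homogeneousComponent_of_mem (isHomogeneous_map hρ (homogeneousComponent_isHomogeneous i f)),
    homogeneousComponent_of_mem (homogeneousComponent_isHomogeneous i f)]
  split_ifs <;> simp

theorem mem_pow_idealOfVars_of_isHomogeneous {d k : ℕ} {f : MvPolynomial σ K}
    (hf : f.IsHomogeneous d) (hk : k ≤ d) : f ∈ idealOfVars σ K ^ k := by
  rw [mem_pow_idealOfVars_iff']
  exact fun x hx => hf.coeff_eq_zero (by omega)

theorem pow_idealOfVars_le {t : ℕ} {J : Ideal (MvPolynomial σ K)}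
    (h : ∀ f : MvPolynomial σ K, f.IsHomogeneous t → f ∈ J) : idealOfVars σ K ^ t ≤ J := by
  rw [pow_idealOfVars_eq_span, Ideal.span_le]
  rintro _ ⟨s, hs, rfl⟩
  exact h _ (isHomogeneous_monomial _ hs)

theorem isHomogeneous_multiset_prod (s : Multiset (MvPolynomial σ K))
    (hs : ∀ a ∈ s, a.IsHomogeneous 1) : s.prod.IsHomogeneous (Multiset.card s) := by
  induction s using Multiset.induction_on with
  | empty => simpa using isHomogeneous_one σ K
  | cons a s ih =>
    rw [Multiset.prod_cons, Multiset.card_cons, add_comm]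
    exact (hs a (by simp)).mul (ih fun b hb => hs b (by simp [hb]))

theorem eq_C_mul_X_pow {d : ℕ} {f : MvPolynomial (Fin 1) K} (hf : f.IsHomogeneous d) :
    f = C (coeff (Finsupp.single 0 d) f) * X 0 ^ d := by
  ext m
  rw [coeff_C_mul, coeff_X_pow]
  by_cases h : Finsupp.single 0 d = m
  · simp [h]
  · rw [if_neg h, mul_zero]
    refine hf.coeff_eq_zero fun hd => h ?_
    ext
    simpa [Finsupp.degree_eq_sum] using hd.symm

theorem isHomogeneous_ideal_pow {I : Ideal (MvPolynomial σ K)}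
    (hI : I.IsHomogeneous (homogeneousSubmodule σ K)) (k : ℕ) :
    (I ^ k).IsHomogeneous (homogeneousSubmodule σ K) := by
  induction k with
  | zero => simpa using Ideal.IsHomogeneous.top _
  | succ k ih => exact pow_succ I k ▸ ih.mul hI

end Homogeneous

section Hyperplane

variable {K : Type*} [Field K] {n : ℕ}

/-- `ρ` is restriction of polynomials to the hyperplane `x = 0`, in linear coordinates on it, and
`τ` is a linear section of `ρ`. -/
structure IsRestriction (x : MvPolynomial (Fin (n + 1)) K)
    (ρ : MvPolynomial (Fin (n + 1)) K →ₐ[K] MvPolynomial (Fin n) K)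
    (τ : MvPolynomial (Fin n) K →ₐ[K] MvPolynomial (Fin (n + 1)) K) : Prop where
  hom : ∀ i, (ρ (X i)).IsHomogeneous 1
  hom_section : ∀ j, (τ (X j)).IsHomogeneous 1
  apply_section : ∀ f, ρ (τ f) = f
  apply_eq_zero_iff : ∀ f, ρ f = 0 ↔ x ∣ f

theorem exists_isRestriction {x : MvPolynomial (Fin (n + 1)) K} (hx : x.IsHomogeneous 1)
    (hx0 : x ≠ 0) : ∃ ρ τ, IsRestriction x ρ τ := by
  set c : Fin (n + 1) → K := fun i => coeff (Finsupp.single i 1) x with hc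
  have hxc : x = ∑ i, C (c i) * X i := eq_sum_of_isHomogeneous_one hx
  obtain ⟨k, hk⟩ : ∃ k, c k ≠ 0 := by
    by_contra! h
    exact hx0 (by rw [hxc]; simp [h])
  set v : MvPolynomial (Fin n) K := C (-(c k)⁻¹) * ∑ j, C (c (k.succAbove j)) * X j with hv
  set ρ : MvPolynomial (Fin (n + 1)) K →ₐ[K] MvPolynomial (Fin n) K :=
    aeval (k.insertNth (α := fun _ => MvPolynomial (Fin n) K) v X) with hρ
  set τ : MvPolynomial (Fin n) K →ₐ[K] MvPolynomial (Fin (n + 1)) K :=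
    aeval (fun j => X (k.succAbove j)) with hτ
  have hρk : ρ (X k) = v := by simp [hρ]
  have hρs : ∀ j, ρ (X (k.succAbove j)) = X j := by simp [hρ]
  have hρτ : ∀ f, ρ (τ f) = f := by
    intro f
    have : ρ.comp τ = AlgHom.id K _ := by
      ext j
      simp [hτ, hρs]
    exact DFunLike.congr_fun this f
  have hρx : ρ x = 0 := by
    rw [hxc, map_sum, Fin.sum_univ_succAbove _ k]
    simp only [map_mul, hρk, hρs, algHom_C, algebraMap_eq]
    rw [hv, ← mul_assoc, ← C_mul, mul_neg, mul_inv_cancel₀ hk]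
    simp
  have hgen : ∀ i, x ∣ X i - τ (ρ (X i)) := by
    intro i
    rcases k.eq_self_or_eq_succAbove i with rfl | ⟨j, rfl⟩
    · refine ⟨C (c i)⁻¹, ?_⟩
      rw [hρk, hv, map_mul, map_sum]
      simp only [map_mul, algHom_C, algebraMap_eq]
      rw [hxc, Fin.sum_univ_succAbove _ i]
      simp only [hτ, aeval_X, C_neg]
      have : C (c i) * C (c i)⁻¹ = (1 : MvPolynomial (Fin (n + 1)) K) := by
        rw [← C_mul, mul_inv_cancel₀ hk, C_1]
      linear_combination (-X i) * this
    · simp [hρs, hτ]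
  have hker : ∀ f, x ∣ f - τ (ρ f) := by
    intro f
    have : (Ideal.Quotient.mkₐ K (Ideal.span {x})).comp (τ.comp ρ) =
        Ideal.Quotient.mkₐ K (Ideal.span {x}) := by
      ext i
      simp only [AlgHom.comp_apply, Ideal.Quotient.mkₐ_eq_mk]
      exact (Ideal.Quotient.eq.2 (Ideal.mem_span_singleton.2 (hgen i))).symm
    exact Ideal.mem_span_singleton.1 (Ideal.Quotient.eq.1 (DFunLike.congr_fun this f).symm)
  refine ⟨ρ, τ, ⟨fun i => ?_, fun j => ?_, hρτ, fun f => ⟨fun h => ?_, ?_⟩⟩⟩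
  · rcases k.eq_self_or_eq_succAbove i with rfl | ⟨j, rfl⟩
    · rw [hρk, hv]
      exact (IsHomogeneous.sum _ _ _ fun j _ => (isHomogeneous_X _ _).C_mul _).C_mul _
    · rw [hρs]; exact isHomogeneous_X _ _
  · simp only [hτ, aeval_X]; exact isHomogeneous_X _ _
  · simpa [h] using hker f
  · rintro ⟨g, rfl⟩
    rw [map_mul, hρx, zero_mul]

/-- The point of the hyperplane with coordinates `q`. -/
noncomputable def liftPoint (ρ : MvPolynomial (Fin (n + 1)) K →ₐ[K] MvPolynomial (Fin n) K)
    (q : Fin n → K) : Fin (n + 1) → K :=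
  fun i => eval q (ρ (X i))

theorem eval_liftPoint (ρ : MvPolynomial (Fin (n + 1)) K →ₐ[K] MvPolynomial (Fin n) K)
    (q : Fin n → K) (f : MvPolynomial (Fin (n + 1)) K) :
    eval (liftPoint ρ q) f = eval q (ρ f) := by
  have : aeval (R := K) (liftPoint ρ q) = (aeval (R := K) q).comp ρ := by
    ext i
    simp [liftPoint, aeval_eq_eval]
  simpa [aeval_eq_eval] using DFunLike.congr_fun this f

namespace IsRestriction

variable {x : MvPolynomial (Fin (n + 1)) K}
  {ρ : MvPolynomial (Fin (n + 1)) K →ₐ[K] MvPolynomial (Fin n) K}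
  {τ : MvPolynomial (Fin n) K →ₐ[K] MvPolynomial (Fin (n + 1)) K}

theorem apply_self (h : IsRestriction x ρ τ) : ρ x = 0 :=
  (h.apply_eq_zero_iff x).2 dvd_rfl

theorem surjective (h : IsRestriction x ρ τ) : Function.Surjective ρ :=
  fun f => ⟨τ f, h.apply_section f⟩

theorem eval_liftPoint_self (h : IsRestriction x ρ τ) (q : Fin n → K) :
    eval (liftPoint ρ q) x = 0 := by
  rw [eval_liftPoint, h.apply_self, map_zero]

theorem liftPoint_ne_zero (h : IsRestriction x ρ τ) {q : Fin n → K} (hq : q ≠ 0) :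
    liftPoint ρ q ≠ 0 := by
  contrapose! hq
  ext j
  have h1 := eval_liftPoint ρ q (τ (X j))
  rw [h.apply_section, eval_X, hq] at h1
  have h2 := eval_smul_of_isHomogeneous_one (h.hom_section j) 0 0
  rw [smul_zero, zero_mul] at h2
  rw [← h1, h2, Pi.zero_apply]

theorem exists_liftPoint_eq (h : IsRestriction x ρ τ) {q : Fin (n + 1) → K}
    (hq : eval q x = 0) : ∃ q', liftPoint ρ q' = q := by
  refine ⟨fun j => eval q (τ (X j)), funext fun i => ?_⟩
  have h1 : ∀ f, eval (fun j => eval q (τ (X j))) f = eval q (τ f) := by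
    intro f
    have : aeval (R := K) (fun j => eval q (τ (X j))) = (aeval (R := K) q).comp τ := by
      ext j
      simp [aeval_eq_eval]
    simpa [aeval_eq_eval] using DFunLike.congr_fun this f
  obtain ⟨g, hg⟩ := (h.apply_eq_zero_iff (τ (ρ (X i)) - X i)).1 (by
    rw [map_sub, h.apply_section, sub_self])
  rw [liftPoint, h1, ← sub_eq_zero, ← eval_X (f := q) i, ← map_sub, hg, map_mul, hq, zero_mul]

theorem prime (h : IsRestriction x ρ τ) (hx0 : x ≠ 0) : Prime x := by
  refine ⟨hx0, fun hu => ?_, fun a b hab => ?_⟩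
  · have := hu.map ρ
    rw [h.apply_self] at this
    exact not_isUnit_zero this
  · rw [← h.apply_eq_zero_iff, map_mul, mul_eq_zero] at hab
    exact hab.imp (h.apply_eq_zero_iff a).1 (h.apply_eq_zero_iff b).1

theorem apply_ne_zero (h : IsRestriction x ρ τ) (hx : x.IsHomogeneous 1) (hx0 : x ≠ 0)
    {y : MvPolynomial (Fin (n + 1)) K} (hy : y.IsHomogeneous 1) (hxy : ∀ c : K, y ≠ c • x) :
    ρ y ≠ 0 := by
  rw [Ne, h.apply_eq_zero_iff]
  rintro ⟨g, rfl⟩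
  have hg : g.IsHomogeneous 0 := isHomogeneous_of_mul hx hx0 (by simpa using hy)
  rw [← totalDegree_zero_iff_isHomogeneous, totalDegree_eq_zero_iff_eq_C] at hg
  refine hxy (coeff 0 g) ?_
  rw [smul_eq_C_mul, ← hg, mul_comm]

end IsRestriction

end Hyperplane

section VanishingOrder

variable {K σ τ : Type*} [Field K]

/-- The expansion `f ↦ f (q + T x)` of polynomials at the point `q`. -/
noncomputable def expandAt (q : σ → K) :
    MvPolynomial σ K →ₐ[K] Polynomial (MvPolynomial σ K) :=
  aeval fun i => Polynomial.C (C (q i)) + Polynomial.X * Polynomial.C (X i)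

/-- The ideal of polynomials vanishing to order at least `k` at `q`. -/
noncomputable def orderIdeal (q : σ → K) (k : ℕ) : Ideal (MvPolynomial σ K) :=
  (Ideal.span {(Polynomial.X : Polynomial (MvPolynomial σ K)) ^ k}).comap (expandAt q)

theorem mem_orderIdeal {q : σ → K} {k : ℕ} {f : MvPolynomial σ K} :
    f ∈ orderIdeal q k ↔ Polynomial.X ^ k ∣ expandAt q f := by
  rw [orderIdeal, Ideal.mem_comap, Ideal.mem_span_singleton]

theorem orderIdeal_zero (q : σ → K) : orderIdeal q 0 = ⊤ :=
  eq_top_iff.2 fun f _ => by simp [mem_orderIdeal]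

theorem orderIdeal_anti (q : σ → K) {k l : ℕ} (h : k ≤ l) : orderIdeal q l ≤ orderIdeal q k :=
  fun _ hf => mem_orderIdeal.2 ((pow_dvd_pow _ h).trans (mem_orderIdeal.1 hf))

theorem orderIdeal_mul_le (q : σ → K) (k l : ℕ) :
    orderIdeal q k * orderIdeal q l ≤ orderIdeal q (k + l) := by
  refine Ideal.mul_le.2 fun f hf g hg => ?_
  rw [mem_orderIdeal] at hf hg ⊢
  rw [map_mul, pow_add]
  exact mul_dvd_mul hf hg

theorem orderIdeal_pow_le (q : σ → K) (k l : ℕ) :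
    orderIdeal q k ^ l ≤ orderIdeal q (l * k) := by
  induction l with
  | zero => simp [orderIdeal_zero]
  | succ l ih =>
    rw [pow_succ, add_mul, one_mul]
    exact (Ideal.mul_mono_left ih).trans (orderIdeal_mul_le q _ _)

theorem expandAt_of_isHomogeneous_one [Fintype σ] (q : σ → K) {x : MvPolynomial σ K}
    (hx : x.IsHomogeneous 1) :
    expandAt q x = Polynomial.C (C (eval q x)) + Polynomial.X * Polynomial.C x := by
  rw [eq_sum_of_isHomogeneous_one hx]
  generalize (fun i => coeff (Finsupp.single i 1) x) = c
  simp only [map_sum, map_mul, Finset.mul_sum, ← Finset.sum_add_distrib, eval_C, eval_X]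
  refine Finset.sum_congr rfl fun i _ => ?_
  simp only [expandAt, aeval_X, algHom_C, IsScalarTower.algebraMap_apply K (MvPolynomial σ K)
    (Polynomial (MvPolynomial σ K)), algebraMap_eq, Polynomial.algebraMap_eq]
  ring

theorem mem_orderIdeal_one_of_eval_eq_zero [Fintype σ] {q : σ → K} {x : MvPolynomial σ K}
    (hx : x.IsHomogeneous 1) (hq : eval q x = 0) : x ∈ orderIdeal q 1 := by
  rw [mem_orderIdeal, expandAt_of_isHomogeneous_one q hx, hq]
  simp

theorem eval_eq_zero_of_mem_orderIdeal {q : σ → K} {k : ℕ} (hk : 1 ≤ k) {f : MvPolynomial σ K}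
    (hf : f ∈ orderIdeal q k) : eval q f = 0 := by
  have h1 := Polynomial.X_dvd_iff.1 (by simpa [mem_orderIdeal] using orderIdeal_anti q hk hf)
  have h2 : ((Polynomial.aeval (0 : MvPolynomial σ K)).restrictScalars K).comp (expandAt q) =
      (Algebra.ofId K (MvPolynomial σ K)).comp (aeval q) := by
    ext1 i
    simp [expandAt, Algebra.ofId_apply]
  have h3 := DFunLike.congr_fun h2 f
  simp only [AlgHom.comp_apply, AlgHom.restrictScalars_apply, aeval_eq_eval,
    ← Polynomial.coeff_zero_eq_aeval_zero, h1, Algebra.ofId_apply, algebraMap_eq] at h3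
  simpa using h3.symm

theorem mem_orderIdeal_of_mul [Fintype σ] {q : σ → K} {k : ℕ} {x g : MvPolynomial σ K}
    (hx : x.IsHomogeneous 1) (hx0 : x ≠ 0) (h : x * g ∈ orderIdeal q k) :
    g ∈ orderIdeal q (k - if eval q x = 0 then 1 else 0) := by
  rw [mem_orderIdeal, map_mul, expandAt_of_isHomogeneous_one q hx] at h
  rw [mem_orderIdeal]
  split_ifs with hq
  · rcases k with - | k
    · simp
    rw [hq, C_0, Polynomial.C_0, zero_add, pow_succ', mul_assoc] at h
    have h := (mul_dvd_mul_iff_left Polynomial.X_ne_zero).1 h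
    refine Polynomial.prime_X.pow_dvd_of_dvd_mul_left k ?_ h
    rw [Polynomial.X_dvd_iff, Polynomial.coeff_C_zero]
    exact hx0
  · refine Polynomial.prime_X.pow_dvd_of_dvd_mul_left k ?_ h
    rw [Polynomial.X_dvd_iff]
    simpa using hq

theorem mem_orderIdeal_of_pow_mul [Fintype σ] {q : σ → K} {k a : ℕ} {x g : MvPolynomial σ K}
    (hx : x.IsHomogeneous 1) (hx0 : x ≠ 0) (h : x ^ a * g ∈ orderIdeal q k) :
    g ∈ orderIdeal q (k - a) := by
  induction a generalizing k with
  | zero => simpa using h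
  | succ a ih =>
    rw [pow_succ', mul_assoc] at h
    have h1 := ih (mem_orderIdeal_of_mul hx hx0 h)
    exact orderIdeal_anti q (by split_ifs <;> omega) h1

theorem map_mem_orderIdeal {n : ℕ} {k : ℕ}
    {ρ : MvPolynomial (Fin (n + 1)) K →ₐ[K] MvPolynomial (Fin n) K}
    (hρ : ∀ i, (ρ (X i)).IsHomogeneous 1) {q : Fin n → K} {f : MvPolynomial (Fin (n + 1)) K}
    (hf : f ∈ orderIdeal (liftPoint ρ q) k) : ρ f ∈ orderIdeal q k := by
  rw [mem_orderIdeal] at hf ⊢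
  have h : (expandAt q).comp ρ =
      (Polynomial.mapAlgHom ρ).comp (expandAt (liftPoint ρ q)) := by
    ext1 i
    rw [AlgHom.comp_apply, expandAt_of_isHomogeneous_one q (hρ i)]
    simp [expandAt, liftPoint, algHom_C]
  have h1 := DFunLike.congr_fun h f
  rw [AlgHom.comp_apply, AlgHom.comp_apply] at h1
  rw [h1]
  have h2 := map_dvd (Polynomial.mapAlgHom ρ) hf
  simpa using h2

/-- The number of members of `s` vanishing at `q`. -/
noncomputable def countZeros (q : σ → K) (s : Multiset (MvPolynomial σ K)) : ℕ :=
  s.countP fun a => eval q a = 0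

theorem countZeros_cons (q : σ → K) (a : MvPolynomial σ K) (s : Multiset (MvPolynomial σ K)) :
    countZeros q (a ::ₘ s) = countZeros q s + if eval q a = 0 then 1 else 0 :=
  Multiset.countP_cons _ _ _

theorem countZeros_map {n : ℕ} (ρ : MvPolynomial (Fin (n + 1)) K →ₐ[K] MvPolynomial (Fin n) K)
    (q : Fin n → K) (s : Multiset (MvPolynomial (Fin (n + 1)) K)) :
    countZeros q (s.map ρ) = countZeros (liftPoint ρ q) s := by
  induction s using Multiset.induction_on with
  | empty => rfl
  | cons a s ih => rw [Multiset.map_cons, countZeros_cons, countZeros_cons, ih, eval_liftPoint]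

end VanishingOrder

section BinaryForms

variable {K : Type*} [Field K]

theorem countZeros_smul {σ : Type*} [Fintype σ] {c : K} (hc : c ≠ 0) (q : σ → K)
    (s : Multiset (MvPolynomial σ K)) (hs : ∀ a ∈ s, a.IsHomogeneous 1) :
    countZeros (c • q) s = countZeros q s := by
  refine Multiset.countP_congr rfl fun a ha => ?_
  simp [eval_smul_of_isHomogeneous_one (hs a ha), hc]

theorem countZeros_add {σ : Type*} (q : σ → K) (s t : Multiset (MvPolynomial σ K)) :
    countZeros q (s + t) = countZeros q s + countZeros q t :=
  Multiset.countP_add _ _ _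

theorem countZeros_nsmul {σ : Type*} (q : σ → K) (k : ℕ) (s : Multiset (MvPolynomial σ K)) :
    countZeros q (k • s) = k * countZeros q s :=
  Multiset.countP_nsmul _ _ _

theorem card_le_of_prod_dvd {σ : Type*} {s : Multiset (MvPolynomial σ K)}
    (hs : ∀ a ∈ s, a.IsHomogeneous 1) {d : ℕ} {g : MvPolynomial σ K} (hg : g.IsHomogeneous d)
    (hg0 : g ≠ 0) (h : s.prod ∣ g) : Multiset.card s ≤ d := by
  obtain ⟨u, rfl⟩ := h
  have h1 := hg.totalDegree hg0
  rw [totalDegree_mul_of_isDomain (left_ne_zero_of_mul hg0) (right_ne_zero_of_mul hg0),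
    (isHomogeneous_multiset_prod s hs).totalDegree (left_ne_zero_of_mul hg0)] at h1
  omega

theorem eq_C_eval_mul_X_pow {d : ℕ} {f : MvPolynomial (Fin 1) K} (hf : f.IsHomogeneous d) :
    f = C (eval (fun _ => 1) f) * X 0 ^ d := by
  obtain ⟨c, rfl⟩ : ∃ c, f = C c * X 0 ^ d := ⟨_, eq_C_mul_X_pow hf⟩
  simp

namespace IsRestriction

variable {x : MvPolynomial (Fin 2) K} {ρ : MvPolynomial (Fin 2) K →ₐ[K] MvPolynomial (Fin 1) K}
  {τ : MvPolynomial (Fin 1) K →ₐ[K] MvPolynomial (Fin 2) K}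

theorem exists_eq_smul (h : IsRestriction x ρ τ) {q : Fin 2 → K} (hq : eval q x = 0) :
    ∃ c : K, q = c • liftPoint ρ (fun _ => 1) := by
  obtain ⟨a, rfl⟩ := h.exists_liftPoint_eq hq
  refine ⟨a 0, funext fun i => ?_⟩
  have ha : a = a 0 • (fun _ => (1 : K)) := by
    ext j
    fin_cases j
    simp
  rw [Pi.smul_apply, liftPoint, liftPoint, smul_eq_mul,
    ← eval_smul_of_isHomogeneous_one (h.hom i), ← ha]

theorem dvd_of_eval_eq_zero (h : IsRestriction x ρ τ) {d : ℕ} {f : MvPolynomial (Fin 2) K}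
    (hf : f.IsHomogeneous d) (h0 : eval (liftPoint ρ fun _ => 1) f = 0) : x ∣ f := by
  rw [← h.apply_eq_zero_iff, eq_C_eval_mul_X_pow (isHomogeneous_map h.hom hf), ← eval_liftPoint,
    h0, C_0, zero_mul]

theorem liftPoint_one_ne_zero (h : IsRestriction x ρ τ) : liftPoint ρ (fun _ => 1) ≠ 0 :=
  h.liftPoint_ne_zero fun h0 => one_ne_zero (congrFun h0 0)

theorem pow_idealOfVars_succ_le (h : IsRestriction x ρ τ) (hx : x.IsHomogeneous 1) (hx0 : x ≠ 0)
    {t : ℕ} {f : MvPolynomial (Fin 2) K} (hf : f.IsHomogeneous (t + 1))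
    (h0 : eval (liftPoint ρ fun _ => 1) f ≠ 0) :
    idealOfVars (Fin 2) K ^ (t + 1) ≤
      Ideal.span {f} ⊔ Ideal.span {x} * idealOfVars (Fin 2) K ^ t := by
  refine pow_idealOfVars_le fun u hu => ?_
  set c := eval (liftPoint ρ fun _ => 1) u / eval (liftPoint ρ fun _ => 1) f with hc
  have hv : (u - C c * f).IsHomogeneous (t + 1) := hu.sub (hf.C_mul c)
  obtain ⟨w, hw⟩ := h.dvd_of_eval_eq_zero hv (by
    rw [map_sub, map_mul, eval_C, hc, div_mul_cancel₀ _ h0, sub_self])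
  rw [hw, add_comm] at hv
  have hw' := isHomogeneous_of_mul hx hx0 hv
  rw [show u = C c * f + x * w by rw [← hw]; ring]
  exact Ideal.add_mem _
    (Ideal.mem_sup_left (Ideal.mul_mem_left _ _ (Ideal.mem_span_singleton_self f)))
    (Ideal.mem_sup_right (Ideal.mul_mem_mul (Ideal.mem_span_singleton_self x)
      (mem_pow_idealOfVars_of_isHomogeneous hw' le_rfl)))

end IsRestriction

theorem prod_dvd_of_mem_orderIdeal (s : Multiset (MvPolynomial (Fin 2) K))
    (hs : ∀ a ∈ s, a.IsHomogeneous 1) (hs0 : ∀ a ∈ s, a ≠ 0) {d : ℕ} {g : MvPolynomial (Fin 2) K}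
    (hg : g.IsHomogeneous d) (h : ∀ q ≠ 0, g ∈ orderIdeal q (countZeros q s)) : s.prod ∣ g := by
  induction s using Multiset.induction_on generalizing d g with
  | empty => simp
  | cons a s ih =>
    have ha := hs a (by simp)
    have ha0 := hs0 a (by simp)
    obtain ⟨ρ, τ, hρ⟩ := exists_isRestriction ha ha0
    have h0 : eval (liftPoint ρ fun _ => 1) g = 0 := by
      refine eval_eq_zero_of_mem_orderIdeal ?_ (h _ hρ.liftPoint_one_ne_zero)
      rw [countZeros_cons, if_pos (hρ.eval_liftPoint_self _)]
      omega
    obtain ⟨u, rfl⟩ := hρ.dvd_of_eval_eq_zero hg h0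
    rcases eq_or_ne (a * u) 0 with hz | hz
    · rw [hz]; exact dvd_zero _
    have hd : 1 ≤ d := by
      simpa using card_le_of_prod_dvd (s := {a}) (by simpa using ha) hg hz (by simp)
    obtain ⟨e, rfl⟩ := Nat.exists_eq_add_of_le hd
    rw [Multiset.prod_cons]
    refine mul_dvd_mul_left a (ih (fun b hb => hs b (by simp [hb])) (fun b hb => hs0 b (by simp [hb]))
      (isHomogeneous_of_mul ha ha0 hg) fun q hq => ?_)
    have h1 := mem_orderIdeal_of_mul ha ha0 (h q hq)
    rwa [countZeros_cons, Nat.add_sub_cancel] at h1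

end BinaryForms

section StarIdeal

/-- The ideal generated by the products of all but one of the members of a list. -/
noncomputable def starIdeal {R : Type*} [CommRing R] : List R → Ideal R
  | [] => ⊥
  | a :: l => Ideal.span {l.prod} ⊔ Ideal.span {a} * starIdeal l

theorem starIdeal_singleton {R : Type*} [CommRing R] (a : R) : starIdeal [a] = ⊤ := by
  simp [starIdeal]

theorem map_starIdeal {R S : Type*} [CommRing R] [CommRing S] (φ : R →+* S) (l : List R) :
    (starIdeal l).map φ = starIdeal (l.map φ) := by
  induction l with
  | nil => simp [starIdeal]
  | cons a l ih =>
    simp [starIdeal, Ideal.map_sup, Ideal.map_mul, Ideal.map_span, ih, map_list_prod]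

variable {K : Type*} [Field K]

theorem exists_starIdeal_ge (l : List (MvPolynomial (Fin 2) K)) (hl : l ≠ [])
    (hom : ∀ a ∈ l, a.IsHomogeneous 1) (hne : ∀ a ∈ l, a ≠ 0) :
    ∃ (G D : Multiset (MvPolynomial (Fin 2) K)) (t : ℕ), (l : Multiset _) = G + D ∧
      Multiset.card D = t + 1 ∧
      (∀ q ≠ 0, countZeros q D ≤ 1 ∧ (countZeros q D = 0 → countZeros q G = 0)) ∧
      Ideal.span {G.prod} * idealOfVars (Fin 2) K ^ t ≤ starIdeal l := by
  induction l with
  | nil => exact absurd rfl hl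
  | cons x l ih =>
    rcases eq_or_ne l [] with rfl | hl
    · refine ⟨0, {x}, 0, by simp, by simp, fun q _ => ⟨?_, fun _ => by simp [countZeros]⟩, ?_⟩
      · exact (Multiset.countP_le_card _ _).trans (by simp)
      · rw [starIdeal_singleton]; exact le_top
    obtain ⟨G, D, t, hGD, hD, hc, hle⟩ := ih hl (fun a ha => hom a (by simp [ha]))
      fun a ha => hne a (by simp [ha])
    have hx := hom x (by simp)
    have hx0 := hne x (by simp)
    have hDl : ∀ a ∈ D, a ∈ l := fun a ha => by
      rw [← Multiset.mem_coe, hGD]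
      exact Multiset.mem_add.2 (Or.inr ha)
    have hDhom : ∀ a ∈ D, a.IsHomogeneous 1 := fun a ha => hom a (by simp [hDl a ha])
    obtain ⟨ρ, τ, hρ⟩ := exists_isRestriction hx hx0
    set p := liftPoint ρ (fun _ => 1) with hp
    have hzero : ∀ q ≠ 0, eval q x = 0 → countZeros q D = countZeros p D := by
      intro q hq hqx
      obtain ⟨c, rfl⟩ := hρ.exists_eq_smul hqx
      exact countZeros_smul (fun h => hq (by simp [h])) _ _ hDhom
    by_cases hpD : countZeros p D = 0
    · refine ⟨G, x ::ₘ D, t + 1, by rw [← Multiset.cons_coe, hGD, Multiset.add_cons],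
        by simp [hD], fun q hq => ?_, ?_⟩
      · rw [countZeros_cons]
        obtain ⟨h1, h2⟩ := hc q hq
        refine ⟨?_, fun h => h2 (by omega)⟩
        split_ifs with h
        · rw [hzero q hq h, hpD]
        · exact h1
      · have hDp : eval p D.prod ≠ 0 := by
          rw [map_multiset_prod, Ne, Multiset.prod_eq_zero_iff]
          rw [countZeros, Multiset.countP_eq_zero] at hpD
          simpa using hpD
        have h1 := hρ.pow_idealOfVars_succ_le hx hx0
          (hD ▸ isHomogeneous_multiset_prod D hDhom) hDp
        refine (Ideal.mul_mono_right h1).trans ?_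
        rw [Ideal.mul_sup, Ideal.span_singleton_mul_span_singleton, ← Multiset.prod_add, ← hGD,
          Multiset.prod_coe, mul_left_comm]
        exact sup_le_sup le_rfl (Ideal.mul_mono_right hle)
    · refine ⟨x ::ₘ G, D, t, by rw [← Multiset.cons_coe, hGD, Multiset.cons_add], hD,
        fun q hq => ⟨(hc q hq).1, fun h => ?_⟩, ?_⟩
      · rw [countZeros_cons, (hc q hq).2 h, if_neg]
        intro hqx
        exact hpD (hzero q hq hqx ▸ h)
      · rw [Multiset.prod_cons, ← Ideal.span_singleton_mul_span_singleton, mul_assoc]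
        exact (Ideal.mul_mono_right hle).trans le_sup_right

theorem mem_starIdeal_of_binary {l : List (MvPolynomial (Fin 2) K)} (hl : l ≠ [])
    (hom : ∀ a ∈ l, a.IsHomogeneous 1) (hne : ∀ a ∈ l, a ≠ 0) {r k d : ℕ} (hk : k ≤ r)
    {g : MvPolynomial (Fin 2) K} (hg : g.IsHomogeneous d) (hd : r * l.length ≤ d + k)
    (h : ∀ q ≠ 0, g ∈ orderIdeal q (r * countZeros q (l : Multiset _) - k)) :
    g ∈ Ideal.span {l.prod} ^ (r - k) * starIdeal l ^ k := by
  rcases eq_or_ne g 0 with rfl | hg0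
  · exact zero_mem _
  obtain ⟨G, D, t, hGD, hD, hc, hle⟩ := exists_starIdeal_ge l hl hom hne
  obtain ⟨m, rfl⟩ := Nat.exists_eq_add_of_le' hk
  rw [Nat.add_sub_cancel]
  have hlen : l.length = Multiset.card G + (t + 1) := by
    rw [← hD, ← Multiset.card_add, ← hGD, Multiset.coe_card]
  have hmem : ∀ a ∈ (m + k) • G + m • D, a ∈ l := fun a ha => by
    rw [← Multiset.mem_coe, hGD]
    rcases Multiset.mem_add.1 ha with ha | ha
    · exact Multiset.mem_add.2 (Or.inl (Multiset.mem_of_mem_nsmul ha))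
    · exact Multiset.mem_add.2 (Or.inr (Multiset.mem_of_mem_nsmul ha))
  obtain ⟨u, hu⟩ := prod_dvd_of_mem_orderIdeal ((m + k) • G + m • D)
    (fun a ha => hom a (hmem a ha)) (fun a ha => hne a (hmem a ha)) hg fun q hq => by
      refine orderIdeal_anti q ?_ (h q hq)
      rw [hGD, countZeros_add, countZeros_add, countZeros_nsmul, countZeros_nsmul]
      obtain ⟨h1, h2⟩ := hc q hq
      rcases Nat.eq_zero_or_pos (countZeros q D) with h3 | h3
      · simp [h3, h2 h3]
      · rw [show countZeros q D = 1 by omega, mul_add]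
        omega
  have hP := isHomogeneous_multiset_prod _ fun a ha => hom a (hmem a ha)
  have hP0 : ((m + k) • G + m • D).prod ≠ 0 := fun h0 => hg0 (by rw [hu, h0, zero_mul])
  have hcard : Multiset.card ((m + k) • G + m • D) + t * k ≤ d := by
    rw [Multiset.card_add, Multiset.card_nsmul, Multiset.card_nsmul, hD]
    rw [hlen] at hd
    nlinarith
  obtain ⟨e, rfl⟩ := Nat.exists_eq_add_of_le (Nat.le_of_add_right_le hcard)
  rw [hu] at hg
  have huM : u ∈ (idealOfVars (Fin 2) K ^ t) ^ k := by
    rw [← pow_mul]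
    exact mem_pow_idealOfVars_of_isHomogeneous (isHomogeneous_of_mul hP hP0 hg) (by omega)
  have hlp : l.prod = G.prod * D.prod := by rw [← Multiset.prod_add, ← hGD, Multiset.prod_coe]
  rw [hu, show ((m + k) • G + m • D).prod * u = l.prod ^ m * (G.prod ^ k * u) by
    rw [Multiset.prod_add, Multiset.prod_nsmul, Multiset.prod_nsmul, hlp]; ring]
  refine Ideal.mul_mem_mul (Ideal.pow_mem_pow (Ideal.mem_span_singleton_self _) m)
    (Ideal.pow_right_mono hle k ?_)
  rw [mul_pow]
  exact Ideal.mul_mem_mul (Ideal.pow_mem_pow (Ideal.mem_span_singleton_self _) k) huM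

end StarIdeal

section PointIdeal

variable {K : Type*} [Field K]

theorem mem_pointIdeal {p : Fin 3 → K} {f : MvPolynomial (Fin 3) K} (hf : f.IsHomogeneous 1)
    (h : eval p f = 0) : f ∈ pointIdeal p :=
  Ideal.subset_span (Set.mem_ofPred.2 ⟨hf, h⟩)

theorem isHomogeneous_pointIdeal (p : Fin 3 → K) :
    (pointIdeal p).IsHomogeneous (homogeneousSubmodule (Fin 3) K) := by
  refine Ideal.homogeneous_span _ _ fun f hf => ⟨1, ?_⟩
  rw [mem_homogeneousSubmodule]
  exact (Set.mem_ofPred.1 hf).1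

theorem homogeneousComponent_mem_iInf_pointIdeal_pow {ι : Type*} (p : ι → Fin 3 → K) (k : ι → ℕ)
    {f : MvPolynomial (Fin 3) K} (hf : f ∈ ⨅ j, pointIdeal (p j) ^ k j) (d : ℕ) :
    homogeneousComponent d f ∈ ⨅ j, pointIdeal (p j) ^ k j :=
  homogeneousComponent_mem_of_mem
    (Ideal.IsHomogeneous.iInf fun j => isHomogeneous_ideal_pow (isHomogeneous_pointIdeal (p j)) _)
    hf d

theorem pointIdeal_pow_le_orderIdeal (p : Fin 3 → K) (k : ℕ) :
    pointIdeal p ^ k ≤ orderIdeal p k := by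
  have h : pointIdeal p ≤ orderIdeal p 1 :=
    Ideal.span_le.2 fun f hf => mem_orderIdeal_one_of_eval_eq_zero hf.1 hf.2
  simpa using (Ideal.pow_right_mono h k).trans (orderIdeal_pow_le p 1 k)

theorem pointIdeal_smul {c : K} (hc : c ≠ 0) (p : Fin 3 → K) :
    pointIdeal (c • p) = pointIdeal p := by
  unfold pointIdeal
  congr 1
  ext f
  refine and_congr_right fun hf => ?_
  rw [eval_smul_of_isHomogeneous_one hf, mul_eq_zero, or_iff_right hc]

theorem list_prod_mem_pointIdeal_pow (p : Fin 3 → K) (l : List (MvPolynomial (Fin 3) K))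
    (hom : ∀ a ∈ l, a.IsHomogeneous 1) :
    l.prod ∈ pointIdeal p ^ countZeros p (l : Multiset (MvPolynomial (Fin 3) K)) := by
  induction l with
  | nil => simp [countZeros]
  | cons a l ih =>
    have hl := ih fun b hb => hom b (by simp [hb])
    rw [← Multiset.cons_coe, countZeros_cons, List.prod_cons, mul_comm, pow_add]
    refine Ideal.mul_mem_mul hl ?_
    split_ifs with h
    · rw [pow_one]
      exact mem_pointIdeal (hom a (by simp)) h
    · simp

theorem starIdeal_le_pointIdeal_pow (p : Fin 3 → K) (l : List (MvPolynomial (Fin 3) K))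
    (hom : ∀ a ∈ l, a.IsHomogeneous 1) :
    starIdeal l ≤ pointIdeal p ^ (countZeros p (l : Multiset (MvPolynomial (Fin 3) K)) - 1) := by
  induction l with
  | nil => exact bot_le
  | cons a l ih =>
    have hl : ∀ b ∈ l, b.IsHomogeneous 1 := fun b hb => hom b (by simp [hb])
    rw [← Multiset.cons_coe, countZeros_cons]
    refine sup_le ?_ ?_
    · rw [Ideal.span_singleton_le_iff_mem]
      exact Ideal.pow_le_pow_right (by split_ifs <;> omega) (list_prod_mem_pointIdeal_pow p l hl)
    · split_ifs with h
      · refine (Ideal.mul_mono ((Ideal.span_singleton_le_iff_mem _).2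
          (mem_pointIdeal (hom a (by simp)) h)) (ih hl)).trans ?_
        rw [← pow_succ']
        exact Ideal.pow_le_pow_right (by omega)
      · exact Ideal.mul_le_right.trans (ih hl)

end PointIdeal

section Plane

variable {K σ : Type*} [Field K]

theorem isHomogeneous_span_singleton {d : ℕ} {f : MvPolynomial σ K} (hf : f.IsHomogeneous d) :
    (Ideal.span {f}).IsHomogeneous (homogeneousSubmodule σ K) :=
  Ideal.homogeneous_span _ _ fun _ hx => ⟨d, by rwa [Set.mem_singleton_iff.1 hx]⟩

theorem isHomogeneous_list_prod (l : List (MvPolynomial σ K)) (hom : ∀ a ∈ l, a.IsHomogeneous 1) :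
    l.prod.IsHomogeneous l.length := by
  simpa using isHomogeneous_multiset_prod (l : Multiset (MvPolynomial σ K)) (by simpa using hom)

theorem isHomogeneous_starIdeal (l : List (MvPolynomial σ K)) (hom : ∀ a ∈ l, a.IsHomogeneous 1) :
    (starIdeal l).IsHomogeneous (homogeneousSubmodule σ K) := by
  induction l with
  | nil => exact Ideal.IsHomogeneous.bot _
  | cons a l ih =>
    have hl : ∀ b ∈ l, b.IsHomogeneous 1 := fun b hb => hom b (by simp [hb])
    exact (isHomogeneous_span_singleton (isHomogeneous_list_prod l hl)).sup
      ((isHomogeneous_span_singleton (hom a (by simp))).mul (ih hl))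

theorem mul_starIdeal_pow_le_orderIdeal (q : Fin 3 → K) (l : List (MvPolynomial (Fin 3) K))
    (hom : ∀ a ∈ l, a.IsHomogeneous 1) (m k : ℕ) :
    Ideal.span {l.prod} ^ m * starIdeal l ^ k ≤
      orderIdeal q (m * countZeros q (l : Multiset (MvPolynomial (Fin 3) K)) +
        k * (countZeros q (l : Multiset (MvPolynomial (Fin 3) K)) - 1)) := by
  have h1 := (Ideal.span_singleton_le_iff_mem _).2 (list_prod_mem_pointIdeal_pow q l hom)
  have h2 := starIdeal_le_pointIdeal_pow q l hom
  refine (Ideal.mul_mono (Ideal.pow_right_mono h1 m) (Ideal.pow_right_mono h2 k)).trans ?_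
  rw [← pow_mul', ← pow_mul', ← pow_add]
  exact pointIdeal_pow_le_orderIdeal q _

theorem pow_mul_mem_starIdeal_pow {R : Type*} [CommRing R] (x : R) (l : List R) {m k : ℕ} {h : R}
    (hh : h ∈ Ideal.span {l.prod} ^ m * starIdeal l ^ k) :
    x ^ k * h ∈ starIdeal (x :: l) ^ (m + k) := by
  have h1 := Ideal.mul_mem_mul (Ideal.pow_mem_pow (Ideal.mem_span_singleton_self x) k) hh
  rw [mul_left_comm, ← mul_pow] at h1
  rw [pow_add]
  exact Ideal.mul_mono (Ideal.pow_right_mono le_sup_left m) (Ideal.pow_right_mono le_sup_right k) h1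

theorem IsRestriction.exists_sub_eq_mul {n : ℕ} {x : MvPolynomial (Fin (n + 1)) K}
    {ρ : MvPolynomial (Fin (n + 1)) K →ₐ[K] MvPolynomial (Fin n) K}
    {τ : MvPolynomial (Fin n) K →ₐ[K] MvPolynomial (Fin (n + 1)) K} (hρ : IsRestriction x ρ τ)
    (hx : x.IsHomogeneous 1) (hx0 : x ≠ 0) {J : Ideal (MvPolynomial (Fin (n + 1)) K)}
    (hJ : J.IsHomogeneous (homogeneousSubmodule (Fin (n + 1)) K)) {d : ℕ}
    {g : MvPolynomial (Fin (n + 1)) K} (hg : g.IsHomogeneous (d + 1))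
    (h : ρ g ∈ J.map (ρ : MvPolynomial (Fin (n + 1)) K →+* MvPolynomial (Fin n) K)) :
    ∃ u ∈ J, ∃ v : MvPolynomial (Fin (n + 1)) K, v.IsHomogeneous d ∧ g - u = x * v := by
  obtain ⟨u, hu, hug⟩ := (Ideal.mem_map_iff_of_surjective _ hρ.surjective).1 h
  refine ⟨homogeneousComponent (d + 1) u, homogeneousComponent_mem_of_mem hJ hu _, ?_⟩
  have h0 : ρ (g - homogeneousComponent (d + 1) u) = 0 := by
    rw [map_sub, ← homogeneousComponent_map hρ.hom, show ρ u = ρ g from hug,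
      homogeneousComponent_eq_self (isHomogeneous_map hρ.hom hg), sub_self]
  obtain ⟨v, hv⟩ := (hρ.apply_eq_zero_iff _).1 h0
  refine ⟨v, isHomogeneous_of_mul hx hx0 ?_, hv⟩
  rw [← hv, add_comm 1 d]
  exact hg.sub (homogeneousComponent_isHomogeneous _ _)

/-- Modulo `⟨∏ l⟩ ^ m * starIdeal l ^ k`, a form with the prescribed vanishing is divisible
by `x`. -/
theorem exists_sub_eq_mul {x : MvPolynomial (Fin 3) K} (hx : x.IsHomogeneous 1) (hx0 : x ≠ 0)
    {l : List (MvPolynomial (Fin 3) K)} (hl : l ≠ []) (hom : ∀ a ∈ l, a.IsHomogeneous 1)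
    (hxl : ∀ a ∈ l, ∀ c : K, a ≠ c • x) {m k d : ℕ} {g : MvPolynomial (Fin 3) K}
    (hg : g.IsHomogeneous (d + 1)) (hd : (m + k) * l.length ≤ d + 1 + k)
    (h : ∀ q ≠ 0, eval q x = 0 →
      g ∈ orderIdeal q ((m + k) * countZeros q (l : Multiset (MvPolynomial (Fin 3) K)) - k)) :
    ∃ u ∈ Ideal.span {l.prod} ^ m * starIdeal l ^ k, ∃ v : MvPolynomial (Fin 3) K,
      v.IsHomogeneous d ∧ g - u = x * v := by
  obtain ⟨ρ, τ, hρ⟩ := exists_isRestriction hx hx0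
  have hJ : (Ideal.span {l.prod} ^ m * starIdeal l ^ k).IsHomogeneous
      (homogeneousSubmodule (Fin 3) K) :=
    (isHomogeneous_ideal_pow (isHomogeneous_span_singleton (isHomogeneous_list_prod l hom)) m).mul
      (isHomogeneous_ideal_pow (isHomogeneous_starIdeal l hom) k)
  refine hρ.exists_sub_eq_mul hx hx0 hJ hg ?_
  have hom' : ∀ a ∈ l.map ρ, a.IsHomogeneous 1 := fun a ha => by
    obtain ⟨b, hb, rfl⟩ := List.mem_map.1 ha
    exact isHomogeneous_map hρ.hom (hom b hb)
  have hne' : ∀ a ∈ l.map ρ, a ≠ 0 := fun a ha => by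
    obtain ⟨b, hb, rfl⟩ := List.mem_map.1 ha
    exact hρ.apply_ne_zero hx hx0 (hom b hb) (hxl b hb)
  have hord : ∀ q ≠ 0, ρ g ∈ orderIdeal q
      ((m + k) * countZeros q (l.map ρ : Multiset (MvPolynomial (Fin 2) K)) - k) := fun q hq => by
    rw [← Multiset.map_coe, countZeros_map]
    exact map_mem_orderIdeal hρ.hom (h _ (hρ.liftPoint_ne_zero hq) (hρ.eval_liftPoint_self q))
  have hmem := mem_starIdeal_of_binary (l := l.map ρ) (by simpa using hl) hom' hne'
    (Nat.le_add_left k m) (isHomogeneous_map hρ.hom hg) (by simpa using hd) hord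
  rw [Nat.add_sub_cancel] at hmem
  rw [Ideal.map_mul, Ideal.map_pow, Ideal.map_pow, map_starIdeal, Ideal.map_span,
    Set.image_singleton, map_list_prod]
  exact hmem

/-- In degrees at least `r * (l.length - 1)`, the powers of `starIdeal l` agree with the symbolic
powers. -/
theorem mem_starIdeal_pow {l : List (MvPolynomial (Fin 3) K)} (hl : l ≠ [])
    (hom : ∀ a ∈ l, a.IsHomogeneous 1) (hne : ∀ a ∈ l, a ≠ 0)
    (hprop : l.Pairwise fun a b => ∀ c : K, b ≠ c • a) {r d : ℕ} {f : MvPolynomial (Fin 3) K}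
    (hf : f.IsHomogeneous d) (hd : r * l.length ≤ d + r)
    (h : ∀ q ≠ 0, f ∈ orderIdeal q (r * (countZeros q (l : Multiset _) - 1))) :
    f ∈ starIdeal l ^ r := by
  induction l generalizing f d with
  | nil => exact absurd rfl hl
  | cons x l ih =>
    rcases eq_or_ne l [] with rfl | hl
    · rw [starIdeal_singleton, Ideal.top_pow]; trivial
    have hx := hom x (by simp)
    have hx0 := hne x (by simp)
    have homl : ∀ a ∈ l, a.IsHomogeneous 1 := fun a ha => hom a (by simp [ha])
    obtain ⟨hxl, hpl⟩ := List.pairwise_cons.1 hprop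
    have hlen : 1 ≤ l.length := List.length_pos_iff.2 hl
    rw [List.length_cons, mul_add, mul_one] at hd
    have key : ∀ k ≤ r, ∃ (g : MvPolynomial (Fin 3) K) (e : ℕ), d = e + k ∧ g.IsHomogeneous e ∧
        f - x ^ k * g ∈ starIdeal (x :: l) ^ r ∧
        ∀ q ≠ 0, g ∈ orderIdeal q (if eval q x = 0 then r * countZeros q (l : Multiset _) - k
          else r * (countZeros q (l : Multiset _) - 1)) := by
      intro k
      induction k with
      | zero =>
        refine fun _ => ⟨f, d, rfl, hf, by simp, fun q hq => orderIdeal_anti q ?_ (h q hq)⟩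
        rw [← Multiset.cons_coe, countZeros_cons]
        split_ifs <;> simp
      | succ k ihk =>
        intro hk
        obtain ⟨g, e, rfl, hg, hfg, hgq⟩ := ihk (by omega)
        obtain ⟨m, rfl⟩ := Nat.exists_eq_add_of_le' hk
        have he : 1 ≤ e := by nlinarith
        obtain ⟨e, rfl⟩ := Nat.exists_eq_add_of_le' he
        obtain ⟨u, hu, v, hv, huv⟩ := exists_sub_eq_mul hx hx0 hl homl hxl (m := m + 1) (k := k) hg
          (by rw [show m + 1 + k = m + (k + 1) by ring]; omega) (fun q hq hqx => by
            have := hgq q hq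
            rwa [if_pos hqx, show m + (k + 1) = m + 1 + k by ring] at this)
        refine ⟨v, e, by ring, hv, ?_, fun q hq => ?_⟩
        · rw [show f - x ^ (k + 1) * v = (f - x ^ k * g) + x ^ k * u by
            rw [pow_succ, mul_assoc, ← huv]; ring]
          refine Ideal.add_mem _ hfg ?_
          rw [show m + (k + 1) = m + 1 + k by ring]
          exact pow_mul_mem_starIdeal_pow x l hu
        · have hu' := mul_starIdeal_pow_le_orderIdeal q l homl _ _ hu
          have h1 := hgq q hq
          set c := countZeros q (l : Multiset _)
          have h2 : u ∈ orderIdeal q (if eval q x = 0 then (m + (k + 1)) * c - k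
              else (m + (k + 1)) * (c - 1)) := by
            refine orderIdeal_anti q ?_ hu'
            rcases Nat.eq_zero_or_pos c with hc | hc
            · simp [hc]
            · obtain ⟨b, hb⟩ := Nat.exists_eq_add_of_le' hc
              rw [hb, Nat.add_sub_cancel]
              split_ifs
              · rw [tsub_le_iff_right]; nlinarith
              · nlinarith
          have h3 := Ideal.sub_mem _ h1 h2
          rw [huv] at h3
          have h4 := mem_orderIdeal_of_mul hx hx0 h3
          refine orderIdeal_anti q ?_ h4
          split_ifs <;> omega
    obtain ⟨g, e, rfl, hg, hfg, hgq⟩ := key r le_rfl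
    have hgm : g ∈ starIdeal l ^ r := by
      refine ih hl homl (fun a ha => hne a (by simp [ha])) hpl hg (by omega) fun q hq => ?_
      have h1 := hgq q hq
      rw [Nat.mul_sub, mul_one] at h1 ⊢
      simpa using h1
    have h2 := pow_mul_mem_starIdeal_pow x l (m := 0) (k := r) (h := g) (by simpa using hgm)
    rw [zero_add] at h2
    simpa using Ideal.add_mem _ hfg h2

end Plane

section Degree

variable {K : Type*} [Field K]

theorem pow_dvd_or_le_of_mem_orderIdeal {x : MvPolynomial (Fin 3) K} (hx : x.IsHomogeneous 1)
    (hx0 : x ≠ 0) {s : Multiset (MvPolynomial (Fin 3) K)} (hs : 1 ≤ Multiset.card s)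
    (hom : ∀ a ∈ s, a.IsHomogeneous 1) (hxs : ∀ a ∈ s, ∀ c : K, a ≠ c • x) {r d : ℕ}
    {f : MvPolynomial (Fin 3) K} (hf : f.IsHomogeneous d) (hf0 : f ≠ 0)
    (h : ∀ q ≠ 0, f ∈ orderIdeal q (2 * r * (countZeros q (x ::ₘ s) - 1))) :
    x ^ r ∣ f ∨ r * (Multiset.card s + 1) ≤ d := by
  obtain ⟨ρ, τ, hρ⟩ := exists_isRestriction hx hx0
  obtain ⟨g, hfg, hg⟩ := (FiniteMultiplicity.of_prime_left (hρ.prime hx0)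
    hf0).exists_eq_pow_mul_and_not_dvd
  generalize multiplicity x f = a at hfg
  subst hfg
  rcases le_or_gt r a with hra | har
  · exact Or.inl ((pow_dvd_pow x hra).trans (dvd_mul_right _ _))
  refine Or.inr ?_
  have hxa : (x ^ a).IsHomogeneous a := by simpa using hx.pow a
  have had : a ≤ d := by
    have h1 := hf.totalDegree hf0
    rw [totalDegree_mul_of_isDomain (pow_ne_zero a hx0) (right_ne_zero_of_mul hf0),
      hxa.totalDegree (pow_ne_zero a hx0)] at h1
    omega
  obtain ⟨e, rfl⟩ := Nat.exists_eq_add_of_le had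
  have hge : g.IsHomogeneous e := isHomogeneous_of_mul hxa (pow_ne_zero a hx0) hf
  have hdvd : ((2 * r - a) • s.map ρ).prod ∣ ρ g := by
    refine prod_dvd_of_mem_orderIdeal _ (fun b hb => ?_) (fun b hb => ?_)
      (isHomogeneous_map hρ.hom hge) fun q hq => ?_
    · obtain ⟨c, hc, rfl⟩ := Multiset.mem_map.1 (Multiset.mem_of_mem_nsmul hb)
      exact isHomogeneous_map hρ.hom (hom c hc)
    · obtain ⟨c, hc, rfl⟩ := Multiset.mem_map.1 (Multiset.mem_of_mem_nsmul hb)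
      exact hρ.apply_ne_zero hx hx0 (hom c hc) (hxs c hc)
    · have h1 := h _ (hρ.liftPoint_ne_zero hq)
      rw [countZeros_cons, if_pos (hρ.eval_liftPoint_self q), Nat.add_sub_cancel] at h1
      refine map_mem_orderIdeal hρ.hom (orderIdeal_anti _ ?_ (mem_orderIdeal_of_pow_mul hx hx0 h1))
      rw [countZeros_nsmul, countZeros_map, Nat.sub_mul]
      rcases Nat.eq_zero_or_pos (countZeros (liftPoint ρ q) s) with hc | hc
      · simp [hc]
      · exact Nat.sub_le_sub_left (Nat.le_mul_of_pos_right a hc) _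
  have hle := card_le_of_prod_dvd (fun b hb => by
    obtain ⟨c, hc, rfl⟩ := Multiset.mem_map.1 (Multiset.mem_of_mem_nsmul hb)
    exact isHomogeneous_map hρ.hom (hom c hc)) (isHomogeneous_map hρ.hom hge)
    (by rwa [Ne, hρ.apply_eq_zero_iff]) hdvd
  rw [Multiset.card_nsmul, Multiset.card_map] at hle
  obtain ⟨k, rfl⟩ := Nat.exists_eq_add_of_lt har
  obtain ⟨c, hc⟩ := Nat.exists_eq_add_of_le' hs
  rw [hc] at hle ⊢
  rw [show 2 * (a + k + 1) - a = a + 2 * k + 2 by omega] at hle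
  nlinarith

theorem mul_card_le_of_mem_orderIdeal {ι : Type*} [Fintype ι] {ℓ : ι → MvPolynomial (Fin 3) K}
    (hι : 2 ≤ Fintype.card ι) (hl : ∀ i, (ℓ i).IsHomogeneous 1) (hnz : ∀ i, ℓ i ≠ 0)
    (hprop : ∀ i j, i ≠ j → ∀ c : K, ℓ i ≠ c • ℓ j) {r d : ℕ} {f : MvPolynomial (Fin 3) K}
    (hf : f.IsHomogeneous d) (hf0 : f ≠ 0)
    (h : ∀ q ≠ 0, f ∈ orderIdeal q (2 * r * (countZeros q (Finset.univ.val.map ℓ) - 1))) :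
    r * Fintype.card ι ≤ d := by
  by_contra hd
  have hdvd : ∀ i, ℓ i ^ r ∣ f := fun i => by
    have hcons : Finset.univ.val.map ℓ = ℓ i ::ₘ (Finset.univ.erase i).val.map ℓ := by
      rw [← Multiset.map_cons, Finset.erase_val, Multiset.cons_erase (Finset.mem_univ_val i)]
    have hcard : Multiset.card ((Finset.univ.erase i).val.map ℓ) + 1 = Fintype.card ι := by
      rw [← Multiset.card_cons, ← hcons, Multiset.card_map]; rfl
    have := pow_dvd_or_le_of_mem_orderIdeal (s := (Finset.univ.erase i).val.map ℓ) (hl i) (hnz i)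
      (by omega)
      (fun a ha => by
        obtain ⟨j, _, rfl⟩ := Multiset.mem_map.1 ha
        exact hl j)
      (fun a ha => by
        obtain ⟨j, hj, rfl⟩ := Multiset.mem_map.1 ha
        exact hprop j i (Finset.ne_of_mem_erase hj))
      hf hf0 (by rwa [← hcons])
    rw [hcard] at this
    exact this.resolve_right hd
  have hprime : ∀ i, Prime (ℓ i) := fun i => by
    obtain ⟨ρ, τ, hρ⟩ := exists_isRestriction (hl i) (hnz i)
    exact hρ.prime (hnz i)
  have hrel : Pairwise (Function.onFun IsRelPrime fun i => ℓ i ^ r) := fun i j hij => by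
    refine IsRelPrime.pow ((hprime i).irreducible.isRelPrime_iff_not_dvd.2 fun hdvd => ?_)
    obtain ⟨ρ, τ, hρ⟩ := exists_isRestriction (hl i) (hnz i)
    exact hρ.apply_ne_zero (hl i) (hnz i) (hl j) (hprop j i hij.symm)
      ((hρ.apply_eq_zero_iff _).2 hdvd)
  have hp : (r • Finset.univ.val.map ℓ).prod ∣ f := by
    rw [Multiset.prod_nsmul]
    have := Fintype.prod_dvd_of_isRelPrime hrel hdvd
    rwa [Finset.prod_pow] at this
  refine hd ?_
  have := card_le_of_prod_dvd (fun a ha => ?_) hf hf0 hp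
  · simpa using this
  · obtain ⟨j, _, rfl⟩ := Multiset.mem_map.1 (Multiset.mem_of_mem_nsmul ha)
    exact hl j

end Degree

section Generation

variable {K σ : Type*} [Field K]

/-- The ideal `J` is generated by forms of degree `e`. -/
def IsGeneratedInDegree (J : Ideal (MvPolynomial σ K)) (e : ℕ) : Prop :=
  ∃ S : Set (MvPolynomial σ K), J = Ideal.span S ∧ ∀ s ∈ S, s.IsHomogeneous e

namespace IsGeneratedInDegree

variable {I J : Ideal (MvPolynomial σ K)} {d e : ℕ}

theorem sup (hI : IsGeneratedInDegree I e) (hJ : IsGeneratedInDegree J e) :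
    IsGeneratedInDegree (I ⊔ J) e := by
  obtain ⟨S, rfl, hS⟩ := hI
  obtain ⟨T, rfl, hT⟩ := hJ
  exact ⟨S ∪ T, (Ideal.span_union S T).symm, fun s hs => hs.elim (hS s) (hT s)⟩

theorem mul (hI : IsGeneratedInDegree I d) (hJ : IsGeneratedInDegree J e) :
    IsGeneratedInDegree (I * J) (d + e) := by
  obtain ⟨S, rfl, hS⟩ := hI
  obtain ⟨T, rfl, hT⟩ := hJ
  refine ⟨Set.image2 (· * ·) S T, Ideal.span_mul_span S T, fun f hf => ?_⟩
  obtain ⟨s, hs, t, ht, rfl⟩ := hf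
  exact (hS s hs).mul (hT t ht)

theorem span_singleton {f : MvPolynomial σ K} (hf : f.IsHomogeneous e) :
    IsGeneratedInDegree (Ideal.span {f}) e :=
  ⟨{f}, rfl, fun _ hs => Set.mem_singleton_iff.1 hs ▸ hf⟩

theorem pow (hI : IsGeneratedInDegree I e) (k : ℕ) : IsGeneratedInDegree (I ^ k) (k * e) := by
  induction k with
  | zero => simpa using span_singleton (isHomogeneous_one σ K)
  | succ k ih =>
    rw [pow_succ, add_mul, one_mul]
    exact ih.mul hI

theorem mem_pow_idealOfVars_mul {k : ℕ} (hJ : IsGeneratedInDegree J e) {f : MvPolynomial σ K}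
    (hf : f.IsHomogeneous d) (hd : e + k ≤ d) (h : f ∈ J) : f ∈ idealOfVars σ K ^ k * J := by
  obtain ⟨S, rfl, hS⟩ := hJ
  obtain ⟨d, rfl⟩ := Nat.exists_eq_add_of_le (le_of_add_le_left hd)
  rw [← homogeneousComponent_eq_self hf]
  clear hf
  induction h using Submodule.closure_induction with
  | zero => simp
  | add a b _ _ ha hb => rw [map_add]; exact add_mem ha hb
  | smul_mem c s hs =>
    rw [smul_eq_mul, mul_comm c s, homogeneousComponent_mul_of_isHomogeneous (hS s hs),
      mul_comm s]
    exact Ideal.mul_mem_mul (mem_pow_idealOfVars_of_isHomogeneous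
      (homogeneousComponent_isHomogeneous d c) (by omega)) (Ideal.subset_span hs)

end IsGeneratedInDegree

theorem isGeneratedInDegree_starIdeal (l : List (MvPolynomial σ K))
    (hom : ∀ a ∈ l, a.IsHomogeneous 1) : IsGeneratedInDegree (starIdeal l) (l.length - 1) := by
  induction l with
  | nil => exact ⟨∅, by simp [starIdeal], by simp⟩
  | cons a l ih =>
    have hl : ∀ b ∈ l, b.IsHomogeneous 1 := fun b hb => hom b (by simp [hb])
    refine (IsGeneratedInDegree.span_singleton (isHomogeneous_list_prod l hl)).sup ?_
    rcases eq_or_ne l [] with rfl | hne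
    · exact ⟨∅, by simp [starIdeal], by simp⟩
    · have := (IsGeneratedInDegree.span_singleton (hom a (by simp))).mul (ih hl)
      rwa [show 1 + (l.length - 1) = l.length by
        have := List.length_pos_iff.2 hne
        omega] at this

end Generation

end FatPoints

open MvPolynomial FatPoints in
/-- Corollary 3.5(2) (Harbourne–Huneke containment): for the fat points ideal `I = ∩ I(P_j)^(n_j - 1)` of a rank-3 arrangement
of `n` lines in `ℙ²_K` (char `K = 0`), one has `I^(2r) ⊆ M^r · I^r` for all `r ≥ 1`,
where `M = ⟨x, y, z⟩`. -/
theorem stmt15 {K : Type*} [Field K] [CharZero K] (n s : ℕ)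
    (ℓ : Fin n → MvPolynomial (Fin 3) K)
    (hl : ∀ i, (ℓ i).IsHomogeneous 1) (hnz : ∀ i, ℓ i ≠ 0)
    (hprop : ∀ i j, i ≠ j → ∀ c : K, ℓ i ≠ c • ℓ j)
    (hrank : ∀ q : Fin 3 → K, (∀ i, MvPolynomial.eval q (ℓ i) = 0) → q = 0)
    (p : Fin s → (Fin 3 → K)) (hp : ∀ j, p j ≠ 0)
    (hpdist : ∀ j k, j ≠ k → ∀ c : K, p j ≠ c • p k)
    (m : Fin s → ℕ)
    (hm : ∀ j, m j = (Finset.univ.filter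
      (fun i => MvPolynomial.eval (p j) (ℓ i) = 0)).card)
    (hsing : ∀ j, 2 ≤ m j)
    (hcomplete : ∀ q : Fin 3 → K, q ≠ 0 →
      2 ≤ (Finset.univ.filter (fun i => MvPolynomial.eval q (ℓ i) = 0)).card →
      ∃ j, ∃ c : K, q = c • p j)
    (r : ℕ) (hr : 1 ≤ r) :
    (⨅ j, pointIdeal (p j) ^ ((2 * r) * (m j - 1))) ≤
      (Ideal.span (Set.range (MvPolynomial.X (R := K) (σ := Fin 3)))) ^ r *
        (⨅ j, pointIdeal (p j) ^ (m j - 1)) ^ r := by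
  have hn : 2 ≤ n := by
    by_contra hn
    rcases (by omega : n = 0 ∨ n = 1) with rfl | rfl
    · have h := hrank (fun _ => 1) fun i => i.elim0
      exact one_ne_zero (congrFun h 0)
    · obtain ⟨ρ, τ, hρ⟩ := exists_isRestriction (hl 0) (hnz 0)
      refine hρ.liftPoint_ne_zero (q := fun _ => 1) (fun h => one_ne_zero (congrFun h 0))
        (hrank _ fun i => ?_)
      rw [Subsingleton.elim i 0]
      exact hρ.eval_liftPoint_self _
  set A := List.ofFn ℓ with hA
  have hlen : A.length = n := List.length_ofFn
  have hne : A ≠ [] := List.length_pos_iff.1 (by omega)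
  have hcoe : (A : Multiset (MvPolynomial (Fin 3) K)) = Finset.univ.val.map ℓ :=
    (Fin.univ_val_map ℓ).symm
  have hom : ∀ a ∈ A, a.IsHomogeneous 1 := (List.forall_mem_ofFn_iff).2 hl
  have hne0 : ∀ a ∈ A, a ≠ 0 := (List.forall_mem_ofFn_iff).2 hnz
  have hcount : ∀ q : Fin 3 → K, countZeros q (A : Multiset (MvPolynomial (Fin 3) K)) =
      (Finset.univ.filter fun i => eval q (ℓ i) = 0).card := fun q => by
    rw [hcoe, countZeros, Multiset.countP_map]
    rfl
  have hle : starIdeal A ≤ ⨅ j, pointIdeal (p j) ^ (m j - 1) := le_iInf fun j => by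
    rw [hm j, ← hcount]
    exact starIdeal_le_pointIdeal_pow (p j) A hom
  refine fun f hf => Ideal.mul_mono_right (Ideal.pow_right_mono hle r) ?_
  rw [← sum_homogeneousComponent f]
  refine sum_mem fun e _ => ?_
  have hfe := homogeneousComponent_mem_iInf_pointIdeal_pow p _ hf e
  have hge := homogeneousComponent_isHomogeneous e f
  generalize homogeneousComponent e f = g at hfe hge
  rcases eq_or_ne g 0 with rfl | hg0
  · exact zero_mem _
  have hord : ∀ q ≠ 0, g ∈ orderIdeal q
      (2 * r * (countZeros q (A : Multiset (MvPolynomial (Fin 3) K)) - 1)) := fun q hq => by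
    rcases Nat.lt_or_ge (countZeros q (A : Multiset (MvPolynomial (Fin 3) K))) 2 with h2 | h2
    · rw [show countZeros q (A : Multiset (MvPolynomial (Fin 3) K)) - 1 = 0 by omega, mul_zero,
        orderIdeal_zero]
      trivial
    · obtain ⟨j, c, rfl⟩ := hcomplete q hq (hcount q ▸ h2)
      have hc : c ≠ 0 := left_ne_zero_of_smul hq
      rw [countZeros_smul hc _ _ (by simpa using hom), hcount, ← hm j]
      apply pointIdeal_pow_le_orderIdeal
      rw [pointIdeal_smul hc]
      exact (Ideal.mem_iInf.1 hfe) j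
  have hdeg : r * n ≤ e := by
    have := mul_card_le_of_mem_orderIdeal (by simpa using hn) hl hnz hprop hge hg0
      (by rwa [← hcoe])
    simpa using this
  refine (isGeneratedInDegree_starIdeal A hom).pow r |>.mem_pow_idealOfVars_mul hge ?_ ?_
  · rw [hlen]
    obtain ⟨n, rfl⟩ := Nat.exists_eq_add_of_le' hn
    rw [show n + 2 - 1 = n + 1 by omega]
    nlinarith
  · refine mem_starIdeal_pow hne hom hne0 ?_ hge (by rw [hlen]; omega) fun q hq =>
      orderIdeal_anti q ?_ (hord q hq)
    · rw [hA, List.pairwise_ofFn]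
      exact fun i j hij => hprop j i hij.ne'
    · exact Nat.mul_le_mul_right _ (by omega)
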